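/- Let T be a real 3 × 3 matrix with τ = det T > 0, and let μ_333(T) = (1/2)·μ_302(T) + (1/2)·μ_316(T), where μ_302(T) = ‖T‖_F²‖T⁻¹‖_F²/9 − 1 and μ_316(T) = (τ + 1/τ)/2 − 1. Then μ_333(T) ≥ 0, with equality if and only if T ∈ SO(3), i.e. if and only if T is a rotation matrix. -/

import Mathlib

open Matrix

/-- The squared Frobenius norm of a real matrix. -/
def frobSq {d : ℕ} (T : Matrix (Fin d) (Fin d) ℝ) : ℝ := ∑ i, ∑ j, (T i j) ^ 2

theorem frobSq_eq_trace {d : ℕ} (T : Matrix (Fin d) (Fin d) ℝ) :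
    frobSq T = (Tᵀ * T).trace := by
  simp only [frobSq, trace, diag_apply, mul_apply, transpose_apply, ← sq]
  exact Finset.sum_comm

theorem frobSq_transpose {d : ℕ} (T : Matrix (Fin d) (Fin d) ℝ) : frobSq Tᵀ = frobSq T :=
  Finset.sum_comm

theorem frobSq_nonneg {d : ℕ} (T : Matrix (Fin d) (Fin d) ℝ) : 0 ≤ frobSq T :=
  Finset.sum_nonneg fun _ _ => Finset.sum_nonneg fun _ _ => sq_nonneg _

theorem frobSq_eq_zero_iff {d : ℕ} {T : Matrix (Fin d) (Fin d) ℝ} : frobSq T = 0 ↔ T = 0 := by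
  rw [frobSq_eq_trace, ← conjTranspose_eq_transpose_of_trivial,
    trace_conjTranspose_mul_self_eq_zero_iff]

/-- The defect in the Cauchy–Schwarz inequality `d² ≤ ‖T‖_F² ‖S‖_F²` for `T * S = 1`. -/
theorem frobSq_smul_sub_smul_transpose {d : ℕ} {T S : Matrix (Fin d) (Fin d) ℝ}
    (h : T * S = 1) :
    frobSq (frobSq T • S - (d : ℝ) • Tᵀ) = frobSq T * (frobSq T * frobSq S - (d : ℝ) ^ 2) := by
  have hTS : (T * S).trace = d := by simp [h]
  have hTS' : (Sᵀ * Tᵀ).trace = d := by rw [← transpose_mul, trace_transpose, hTS]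
  have hS := frobSq_eq_trace S
  have hT : frobSq T = (T * Tᵀ).trace := by
    rw [frobSq_eq_trace, trace_mul_comm]
  rw [frobSq_eq_trace (_ - _)]
  simp only [transpose_sub, transpose_smul, transpose_transpose, sub_mul, mul_sub, smul_mul,
    Matrix.mul_smul, trace_sub, trace_smul, smul_eq_mul, hTS, hTS', ← hS, ← hT]
  ring

/-- For a real `3 × 3` matrix `T` with `det T > 0`, the composite
metric `μ_333 = (1/2) μ_302 + (1/2) μ_316`, with
`μ_302(T) = ‖T‖_F²‖T⁻¹‖_F²/9 − 1` and `μ_316(T) = (τ + 1/τ)/2 − 1`, is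
nonnegative, with equality iff `T ∈ SO(3)` (orthogonal with determinant 1,
i.e. a rotation matrix). -/
theorem stmt_11 (T : Matrix (Fin 3) (Fin 3) ℝ) (hτ : 0 < T.det) :
    0 ≤ (1 / 2) * (frobSq T * frobSq T⁻¹ / 9 - 1) +
        (1 / 2) * ((T.det + 1 / T.det) / 2 - 1) ∧
      ((1 / 2) * (frobSq T * frobSq T⁻¹ / 9 - 1) +
        (1 / 2) * ((T.det + 1 / T.det) / 2 - 1) = 0 ↔
        Tᵀ * T = 1 ∧ T.det = 1) := by
  have hunit : IsUnit T.det := hτ.ne'.isUnit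
  have hTS : T * T⁻¹ = 1 := mul_nonsing_inv T hunit
  have hST : T⁻¹ * T = 1 := nonsing_inv_mul T hunit
  have hF : 0 < frobSq T := by
    refine (frobSq_nonneg T).lt_of_ne' fun h => ?_
    rw [frobSq_eq_zero_iff.mp h] at hτ
    simp at hτ
  have hdefect := frobSq_smul_sub_smul_transpose hTS
  push_cast at hdefect
  have hshape : 0 ≤ frobSq T * frobSq T⁻¹ - 3 ^ 2 :=
    nonneg_of_mul_nonneg_right (hdefect ▸ frobSq_nonneg _) hF
  have hsize : (T.det + 1 / T.det) / 2 - 1 = (T.det - 1) ^ 2 / (2 * T.det) := by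
    field_simp
    ring
  have hsize_nonneg : 0 ≤ (T.det - 1) ^ 2 / (2 * T.det) := by positivity
  rw [hsize]
  refine ⟨by linarith, fun h => ?_, fun ⟨horth, hdet⟩ => ?_⟩
  · have hshape_zero : frobSq T * frobSq T⁻¹ - 3 ^ 2 = 0 := by linarith
    have hsize_zero : (T.det - 1) ^ 2 / (2 * T.det) = 0 := by linarith
    have hdet : T.det = 1 := by
      rcases div_eq_zero_iff.mp hsize_zero with h | h
      · exact sub_eq_zero.mp (pow_eq_zero_iff two_ne_zero |>.mp h)
      · linarith
    rw [hshape_zero, mul_zero, frobSq_eq_zero_iff, sub_eq_zero] at hdefect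
    have hmul : frobSq T • (1 : Matrix (Fin 3) (Fin 3) ℝ) = (3 : ℝ) • (Tᵀ * T) := by
      rw [← hST, ← smul_mul, hdefect, smul_mul]
    have hcube : frobSq T ^ 3 = 3 ^ 3 := by
      simpa [det_smul, hdet] using congrArg det hmul
    have hthree : frobSq T = 3 := (pow_left_inj₀ hF.le (by norm_num) (by norm_num)).mp hcube
    rw [hthree] at hmul
    exact ⟨(smul_right_injective _ (three_ne_zero (α := ℝ)) hmul).symm, hdet⟩
  · have hthree : frobSq T = 3 := by simp [frobSq_eq_trace, horth]
    rw [inv_eq_left_inv horth, frobSq_transpose, hthree, hdet]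
    norm_num
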